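/- arXiv:1706.01698 — 5 statements merged into one kernel-verified Lean document; each statement's English description precedes it below -/
import Mathlib

section
/- Let {(y^k, z^k, x^k)}_{k≥0} be a sequence generated by the majorized iPADMM. Then for every k ≥ 0, the KKT residual at u^{k+1} := (y^{k+1}, z^{k+1}, x^{k+1}) satisfies ‖ℛ(u^{k+1})‖² ≤ ‖u^{k+1} − u^k‖²_{ℋ₀}, where ℋ₀ := max{κ₁, κ₂, κ₃}·Diag(I, I + σℬℬ*, (τ²σ)⁻¹I) is a self-adjoint operator on 𝒴 × 𝒵 × 𝒳 with κ₁ := 3(λ_max(𝒮 + ½Σ̂_f) + ½λ_max(Σ̂_f))², κ₂ := max{2(λ_max(𝒯 + ½Σ̂_g) + ½λ_max(Σ̂_g))², 3σλ_max(𝒜*𝒜)}, and κ₃ := σ⁻¹ + (1 − τ)²σ(3λ_max(𝒜*𝒜) + 2λ_max(ℬ*ℬ)), λ_max denoting the largest eigenvalue of a self-adjoint operator. -/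
open scoped RealInnerProductSpace

noncomputable section

/-- the quadratic form `‖w‖²_M := ⟨w, M w⟩` of a linear operator. -/
def quadForm {E : Type*} [NormedAddCommGroup E] [InnerProductSpace ℝ E]
    (M : E →ₗ[ℝ] E) (w : E) : ℝ := ⟪w, M w⟫

/-- convexity of a function with values in `ℝ ∪ {±∞}`. -/
def ERConvex {E : Type*} [AddCommGroup E] [Module ℝ E] (p : E → EReal) : Prop :=
  ∀ x y : E, ∀ a b : ℝ, 0 ≤ a → 0 ≤ b → a + b = 1 →
    p (a • x + b • y) ≤ (a : EReal) * p x + (b : EReal) * p y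

/-- properness of a function with values in `ℝ ∪ {±∞}`: nowhere `−∞`, somewhere finite. -/
def ERProper {E : Type*} (p : E → EReal) : Prop :=
  (∃ x, p x ≠ ⊤) ∧ ∀ x, p x ≠ ⊥

/-- `g` belongs to the convex subdifferential `∂p(x)`. -/
def ERSubgrad {E : Type*} [NormedAddCommGroup E] [InnerProductSpace ℝ E]
    (p : E → EReal) (x g : E) : Prop :=
  ∀ w, p x + ((⟪g, w - x⟫ : ℝ) : EReal) ≤ p w

/-- the set `Ω̄` of KKT points of the problem `min p(y) + f(y) + q(z) + g(z)`
subject to `𝒜*y + ℬ*z = c`. -/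
def KKTset {X Y Z : Type*}
    [NormedAddCommGroup X] [InnerProductSpace ℝ X] [FiniteDimensional ℝ X]
    [NormedAddCommGroup Y] [InnerProductSpace ℝ Y] [FiniteDimensional ℝ Y]
    [NormedAddCommGroup Z] [InnerProductSpace ℝ Z] [FiniteDimensional ℝ Z]
    (A : X →ₗ[ℝ] Y) (B : X →ₗ[ℝ] Z) (c : X)
    (gradf : Y → Y) (gradg : Z → Z) (p : Y → EReal) (q : Z → EReal) :
    Set (Y × Z × X) :=
  {u | ERSubgrad p u.1 (-(gradf u.1 + A u.2.2)) ∧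
       ERSubgrad q u.2.1 (-(gradg u.2.1 + B u.2.2)) ∧
       LinearMap.adjoint A u.1 + LinearMap.adjoint B u.2.1 = c}

/-- the largest eigenvalue of a self-adjoint linear operator, i.e. the supremum of its
Rayleigh quotient over the unit sphere. -/
def lamMax {E : Type*} [NormedAddCommGroup E] [InnerProductSpace ℝ E]
    (M : E →ₗ[ℝ] E) : ℝ :=
  sSup {r : ℝ | ∃ w : E, ‖w‖ = 1 ∧ r = ⟪w, M w⟫}

section KKTResidual

variable {E F : Type*} [NormedAddCommGroup E] [InnerProductSpace ℝ E]
  [NormedAddCommGroup F] [InnerProductSpace ℝ F]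

/-- A symmetric quadratic form expands to second order around any point. -/
theorem quadForm_add {M : E →ₗ[ℝ] E} (hM : M.IsSymmetric) (a d : E) :
    quadForm M (a + d) = quadForm M a + 2 * ⟪M a, d⟫ + quadForm M d := by
  have h : ⟪a, M d⟫ = ⟪M a, d⟫ := (hM a d).symm
  simp only [quadForm, map_add, inner_add_left, inner_add_right, h, real_inner_comm (M a) d]
  ring

theorem quadForm_smul (M : E →ₗ[ℝ] E) (t : ℝ) (d : E) :
    quadForm M (t • d) = t ^ 2 * quadForm M d := by
  simp only [quadForm, map_smul, real_inner_smul_left, real_inner_smul_right]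
  ring

theorem lamMax_nonneg {M : E →ₗ[ℝ] E} (hM : ∀ w, 0 ≤ quadForm M w) : 0 ≤ lamMax M := by
  refine Real.sSup_nonneg ?_
  rintro r ⟨w, -, rfl⟩
  exact hM w

theorem quadForm_le_lamMax [FiniteDimensional ℝ E] (M : E →ₗ[ℝ] E) (w : E) :
    quadForm M w ≤ lamMax M * ‖w‖ ^ 2 := by
  rcases eq_or_ne w 0 with rfl | hw
  · simp [quadForm]
  have hpos : 0 < ‖w‖ := norm_pos_iff.mpr hw
  have hbdd : BddAbove {r : ℝ | ∃ w : E, ‖w‖ = 1 ∧ r = ⟪w, M w⟫} := by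
    refine ⟨‖LinearMap.toContinuousLinearMap M‖, ?_⟩
    rintro r ⟨v, hv, rfl⟩
    calc ⟪v, M v⟫ ≤ ‖v‖ * ‖M v‖ := real_inner_le_norm _ _
      _ ≤ ‖LinearMap.toContinuousLinearMap M‖ := by
        simpa [hv] using (LinearMap.toContinuousLinearMap M).le_opNorm v
  have h : quadForm M (‖w‖⁻¹ • w) ≤ lamMax M :=
    le_csSup hbdd ⟨_, by simp [norm_smul, hpos.ne'], rfl⟩
  rw [quadForm_smul, inv_pow, inv_mul_le_iff₀ (by positivity)] at h
  linarith

theorem norm_sq_le_lamMax_adjoint_comp [FiniteDimensional ℝ E] [FiniteDimensional ℝ F]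
    (A : E →ₗ[ℝ] F) (w : E) :
    ‖A w‖ ^ 2 ≤ lamMax (LinearMap.adjoint A ∘ₗ A) * ‖w‖ ^ 2 := by
  have h := quadForm_le_lamMax (LinearMap.adjoint A ∘ₗ A) w
  simpa only [quadForm, LinearMap.comp_apply, LinearMap.adjoint_inner_right,
    real_inner_self_eq_norm_sq] using h

/-- A two-sided quadratic bound on the linearization error of `φ` makes its gradient Lipschitz
with the same constant. -/
theorem norm_grad_sub_le_of_abs_remainder_le {φ : E → ℝ} {G : E → E} {M : ℝ} (hM : 0 ≤ M)
    (h : ∀ a b, |φ b - φ a - ⟪G a, b - a⟫| ≤ M / 2 * ‖b - a‖ ^ 2) (a b : E) :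
    ‖G b - G a‖ ≤ M * ‖b - a‖ := by
  have key : ∀ e : E, 2 * ⟪G b - G a, e⟫ ≤ M / 2 * (‖b - a‖ ^ 2 + 4 * ‖e‖ ^ 2) := by
    intro e
    have h₁ := (abs_le.mp (h a (a + ((1 / 2 : ℝ) • (b - a) + e)))).2
    have h₂ := (abs_le.mp (h b (b + (e - (1 / 2 : ℝ) • (b - a))))).1
    have h₃ := (abs_le.mp (h b (b + (-(1 / 2 : ℝ) • (b - a) - e)))).2
    have h₄ := (abs_le.mp (h a (a + ((1 / 2 : ℝ) • (b - a) - e)))).1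
    have e₁ : b + (e - (1 / 2 : ℝ) • (b - a)) = a + ((1 / 2 : ℝ) • (b - a) + e) := by module
    have e₂ : b + (-(1 / 2 : ℝ) • (b - a) - e) = a + ((1 / 2 : ℝ) • (b - a) - e) := by module
    simp only [add_sub_cancel_left] at h₁ h₂ h₃ h₄
    rw [e₁] at h₂
    rw [e₂] at h₃
    simp only [← real_inner_self_eq_norm_sq, inner_add_left, inner_add_right, inner_sub_left,
      inner_sub_right, real_inner_smul_left, real_inner_smul_right, real_inner_comm e,
      real_inner_comm a b] at h₁ h₂ h₃ h₄ ⊢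
    linarith
  have hlin : ∀ t : ℝ, 2 * t * ‖G b - G a‖ ^ 2
      ≤ M / 2 * (‖b - a‖ ^ 2 + 4 * t ^ 2 * ‖G b - G a‖ ^ 2) := by
    intro t
    have := key (t • (G b - G a))
    rw [real_inner_smul_right, real_inner_self_eq_norm_sq, norm_smul, mul_pow, Real.norm_eq_abs,
      sq_abs] at this
    linarith
  rcases hM.eq_or_lt with rfl | hM
  · have := hlin 1
    have h0 : ‖G b - G a‖ ^ 2 = 0 := le_antisymm (by linarith) (sq_nonneg _)
    rw [pow_eq_zero_iff two_ne_zero] at h0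
    simp [h0]
  · have := hlin (1 / (2 * M))
    refine abs_le_of_sq_le_sq' ?_ (by positivity) |>.2
    have e₁ : 2 * (1 / (2 * M)) * ‖G b - G a‖ ^ 2 = ‖G b - G a‖ ^ 2 / M := by field_simp
    have e₂ : M / 2 * (‖b - a‖ ^ 2 + 4 * (1 / (2 * M)) ^ 2 * ‖G b - G a‖ ^ 2)
        = M / 2 * ‖b - a‖ ^ 2 + ‖G b - G a‖ ^ 2 / M / 2 := by field_simp; ring
    rw [e₁, e₂] at this
    have h' : ‖G b - G a‖ ^ 2 / M ≤ M * ‖b - a‖ ^ 2 := by linarith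
    rw [div_le_iff₀ hM] at h'
    nlinarith

theorem norm_apply_le_lamMax [FiniteDimensional ℝ E] {M : E →ₗ[ℝ] E} (hM : M.IsSymmetric)
    (hpos : ∀ w, 0 ≤ quadForm M w) (d : E) : ‖M d‖ ≤ lamMax M * ‖d‖ := by
  have h := norm_grad_sub_le_of_abs_remainder_le (φ := fun w => 1 / 2 * quadForm M w)
    (G := M) (lamMax_nonneg hpos) (fun a b => by
      have h₁ := quadForm_add hM a (b - a)
      rw [add_sub_cancel] at h₁
      have h₂ := quadForm_le_lamMax M (b - a)
      have h₃ := hpos (b - a)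
      rw [h₁, abs_le]
      constructor <;> nlinarith) 0 d
  simpa using h

/-- The gradient difference of a convex function whose curvature is at most `N` differs from
`N / 2` by at most half the largest eigenvalue of `N`. -/
theorem norm_half_sub_grad_sub_le [FiniteDimensional ℝ E] {N : E →ₗ[ℝ] E} (hN : N.IsSymmetric)
    (hpos : ∀ w, 0 ≤ quadForm N w) {f : E → ℝ} {gradf : E → E}
    (hlow : ∀ w w', f w' + ⟪gradf w', w - w'⟫ ≤ f w)
    (hup : ∀ w w', f w ≤ f w' + ⟪gradf w', w - w'⟫ + 1 / 2 * quadForm N (w - w')) (a b : E) :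
    ‖(1 / 2 : ℝ) • N (b - a) - (gradf b - gradf a)‖ ≤ 1 / 2 * lamMax N * ‖b - a‖ := by
  have h := norm_grad_sub_le_of_abs_remainder_le (φ := fun w => f w - 1 / 4 * quadForm N w)
    (G := fun w => gradf w - (1 / 2 : ℝ) • N w) (M := 1 / 2 * lamMax N)
    (by have := lamMax_nonneg hpos; positivity) (fun a b => by
      have h₁ := quadForm_add hN a (b - a)
      rw [add_sub_cancel] at h₁
      have h₂ := quadForm_le_lamMax N (b - a)
      have h₃ := hlow b a
      have h₄ := hup b a
      simp only [h₁, inner_sub_left, real_inner_smul_left]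
      rw [abs_le]
      constructor <;> nlinarith) a b
  have e : (1 / 2 : ℝ) • N (b - a) - (gradf b - gradf a)
      = -((gradf b - (1 / 2 : ℝ) • N b) - (gradf a - (1 / 2 : ℝ) • N a)) := by
    rw [map_sub]
    module
  rw [e, norm_neg]
  exact h

/-- First-order optimality for the sum of an extended-valued convex function and a function that
is quadratic along segments issuing from the minimizer. -/
theorem erSubgrad_neg_of_isMin {p : E → EReal} (hconv : ERConvex p) (hbot : ∀ w, p w ≠ ⊥)
    {h : E → ℝ} {u G : E} {Q : E → ℝ}
    (hquad : ∀ (d : E) (t : ℝ), h (u + t • d) = h u + t * ⟪G, d⟫ + t ^ 2 * Q d)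
    (hfin : p u ≠ ⊤) (hmin : ∀ w, p u + (h u : EReal) ≤ p w + (h w : EReal)) :
    ERSubgrad p u (-G) := by
  intro w
  rcases eq_or_ne (p w) ⊤ with hw | hw
  · simp [hw]
  lift p u to ℝ using ⟨hfin, hbot u⟩ with P hP
  have hwc : ∀ t : ℝ, 0 ≤ t → t ≤ 1 →
      p (u + t • (w - u)) ≤ ((1 - t : ℝ) : EReal) * p u + (t : EReal) * p w := by
    intro t h0 h1
    have := hconv u w (1 - t) t (by linarith) h0 (by ring)
    rwa [show (1 - t) • u + t • w = u + t • (w - u) by module] at this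
  lift p w to ℝ using ⟨hw, hbot w⟩ with R hR
  rw [← hP] at hwc
  have key : ∀ t : ℝ, 0 < t → t ≤ 1 → 0 ≤ R - P + ⟪G, w - u⟫ + t * Q (w - u) := by
    intro t h0 h1
    have h₁ := (hmin (u + t • (w - u))).trans (add_le_add_left (hwc t h0.le h1) _)
    rw [hquad] at h₁
    have h₂ : P + h u ≤ (1 - t) * P + t * R + (h u + t * ⟪G, w - u⟫ + t ^ 2 * Q (w - u)) := by
      exact_mod_cast h₁
    have h₃ : 0 ≤ t * (R - P + ⟪G, w - u⟫ + t * Q (w - u)) := by linarith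
    exact nonneg_of_mul_nonneg_right h₃ h0
  have hlim : 0 ≤ R - P + ⟪G, w - u⟫ := by
    by_contra! hneg
    set δ := R - P + ⟪G, w - u⟫
    have hq : 0 < |Q (w - u)| + 1 := by positivity
    have hpos : 0 < min 1 (-δ / (2 * (|Q (w - u)| + 1))) := by
      apply lt_min one_pos
      apply div_pos <;> linarith
    have h₁ := key _ hpos (min_le_left _ _)
    have h₂ := min_le_right 1 (-δ / (2 * (|Q (w - u)| + 1)))
    rw [le_div_iff₀ (by positivity)] at h₂
    nlinarith [le_abs_self (Q (w - u))]
  rw [inner_neg_left]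
  have : P + -⟪G, w - u⟫ ≤ R := by linarith
  exact_mod_cast this

theorem ERSubgrad.inner_sub_nonneg {p : E → EReal} {a b s t : E} (ha : ERSubgrad p a s)
    (hb : ERSubgrad p b t) (hbot : ∀ w, p w ≠ ⊥) (hfa : p a ≠ ⊤) (hfb : p b ≠ ⊤) :
    0 ≤ ⟪s - t, a - b⟫ := by
  have h₁ := ha b
  have h₂ := hb a
  lift p a to ℝ using ⟨hfa, hbot a⟩ with P
  lift p b to ℝ using ⟨hfb, hbot b⟩ with R
  have h₁ : P + ⟪s, b - a⟫ ≤ R := by exact_mod_cast h₁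
  have h₂ : R + ⟪t, a - b⟫ ≤ P := by exact_mod_cast h₂
  rw [← neg_sub a b, inner_neg_right] at h₁
  rw [inner_sub_left]
  linarith

/-- If `-G ∈ ∂p(u)`, the proximal residual of `p` at `u` in the direction `D` is at most
`‖G - D‖`. -/
theorem norm_sub_prox_le {p : E → EReal} (hconv : ERConvex p) (hbot : ∀ w, p w ≠ ⊥)
    {prox : E → E}
    (hprox : ∀ v w, p (prox v) + ((1 / 2 * ‖prox v - v‖ ^ 2 : ℝ) : EReal)
      ≤ p w + ((1 / 2 * ‖w - v‖ ^ 2 : ℝ) : EReal))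
    {u G : E} (hu : p u ≠ ⊤) (hG : ERSubgrad p u (-G)) (D : E) :
    ‖u - prox (u - D)‖ ≤ ‖G - D‖ := by
  set P := prox (u - D) with hPdef
  have hPfin : p P ≠ ⊤ := by
    intro htop
    have h₁ := hprox (u - D) u
    rw [← hPdef, htop, EReal.top_add_coe, top_le_iff] at h₁
    lift p u to ℝ using ⟨hu, hbot u⟩ with R
    exact EReal.coe_ne_top _ (by exact_mod_cast h₁)
  have hP : ERSubgrad p P (-(P - (u - D))) := by
    refine erSubgrad_neg_of_isMin hconv hbot (h := fun w => 1 / 2 * ‖w - (u - D)‖ ^ 2)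
      (Q := fun d => 1 / 2 * ‖d‖ ^ 2) (fun d t => ?_) hPfin (hprox (u - D))
    rw [show P + t • d - (u - D) = (P - (u - D)) + t • d by module, norm_add_sq_real,
      real_inner_smul_right, norm_smul, mul_pow, Real.norm_eq_abs, sq_abs]
    ring
  have hmono := hP.inner_sub_nonneg hG hbot hPfin hu
  have hle : ‖u - P‖ ^ 2 ≤ ⟪G - D, P - u⟫ := by
    rw [show -(P - (u - D)) - -G = (G - D) - (P - u) by module, inner_sub_left,
      real_inner_self_eq_norm_sq, norm_sub_rev] at hmono
    linarith
  have hcs := hle.trans (real_inner_le_norm _ _)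
  rw [norm_sub_rev P u] at hcs
  rcases (norm_nonneg (u - P)).eq_or_lt with h0 | h0
  · rw [← h0]
    exact norm_nonneg _
  · nlinarith

/-- Optimality condition of one linearized proximal augmented Lagrangian subproblem. -/
theorem erSubgrad_of_subproblem [FiniteDimensional ℝ E] [FiniteDimensional ℝ F]
    {p : E → EReal} (hconv : ERConvex p) (hbot : ∀ w, p w ≠ ⊥) (A : F →ₗ[ℝ] E)
    {N : E →ₗ[ℝ] E} (hN : N.IsSymmetric) {σ : ℝ} {u u₀ l : E} {r : E → F} {b : F}
    (hr : ∀ w, r w = LinearMap.adjoint A w + b) (hu : p u ≠ ⊤)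
    (hmin : ∀ w, p u + ((⟪u, l⟫ + σ / 2 * ‖r u‖ ^ 2 + 1 / 2 * quadForm N (u - u₀) : ℝ) : EReal)
      ≤ p w + ((⟪w, l⟫ + σ / 2 * ‖r w‖ ^ 2 + 1 / 2 * quadForm N (w - u₀) : ℝ) : EReal)) :
    ERSubgrad p u (-(l + σ • A (r u) + N (u - u₀))) := by
  refine erSubgrad_neg_of_isMin hconv hbot
    (h := fun w => ⟪w, l⟫ + σ / 2 * ‖r w‖ ^ 2 + 1 / 2 * quadForm N (w - u₀))
    (Q := fun d => σ / 2 * ‖LinearMap.adjoint A d‖ ^ 2 + 1 / 2 * quadForm N d)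
    (fun d t => ?_) hu hmin
  have h₁ : r (u + t • d) = r u + t • LinearMap.adjoint A d := by
    rw [hr, hr, map_add, map_smul]
    module
  have h₂ : u + t • d - u₀ = (u - u₀) + t • d := by module
  simp only [h₁, h₂, quadForm_add hN, quadForm_smul]
  rw [norm_add_sq_real, norm_smul, mul_pow, Real.norm_eq_abs, sq_abs]
  simp only [inner_add_left, real_inner_smul_left, real_inner_smul_right,
    LinearMap.adjoint_inner_right, real_inner_comm d l]
  ring

/-- The curvature part of the residual of a majorized proximal step. -/
theorem norm_majorized_step_le [FiniteDimensional ℝ E] {N S : E →ₗ[ℝ] E}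
    (hN : N.IsSymmetric) (hS : S.IsSymmetric) (hpos : ∀ w, 0 ≤ quadForm N w)
    (hSN : ∀ w, -(1 / 2) * quadForm N w ≤ quadForm S w) {f : E → ℝ} {gradf : E → E}
    (hlow : ∀ w w', f w' + ⟪gradf w', w - w'⟫ ≤ f w)
    (hup : ∀ w w', f w ≤ f w' + ⟪gradf w', w - w'⟫ + 1 / 2 * quadForm N (w - w')) (a b : E) :
    ‖(N + S) (b - a) - (gradf b - gradf a)‖
      ≤ (lamMax (S + (1 / 2 : ℝ) • N) + 1 / 2 * lamMax N) * ‖b - a‖ := by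
  have hsym : (S + (1 / 2 : ℝ) • N).IsSymmetric := by
    intro v w
    simp only [LinearMap.add_apply, LinearMap.smul_apply, inner_add_left, inner_add_right,
      real_inner_smul_left, real_inner_smul_right, hN v w, hS v w]
  have hpsd : ∀ w, 0 ≤ quadForm (S + (1 / 2 : ℝ) • N) w := by
    intro w
    have := hSN w
    simp only [quadForm, LinearMap.add_apply, LinearMap.smul_apply, inner_add_right,
      real_inner_smul_right] at this ⊢
    linarith
  have h₁ := norm_apply_le_lamMax hsym hpsd (b - a)
  have h₂ := norm_half_sub_grad_sub_le hN hpos hlow hup a b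
  have h₃ := norm_add_le ((S + (1 / 2 : ℝ) • N) (b - a))
    ((1 / 2 : ℝ) • N (b - a) - (gradf b - gradf a))
  have e : (N + S) (b - a) - (gradf b - gradf a) = (S + (1 / 2 : ℝ) • N) (b - a)
      + ((1 / 2 : ℝ) • N (b - a) - (gradf b - gradf a)) := by
    simp only [LinearMap.add_apply, LinearMap.smul_apply]
    module
  rw [e]
  linarith

end KKTResidual

theorem norm_add_sq_le_two_mul {E : Type*} [SeminormedAddCommGroup E] (a b : E) :
    ‖a + b‖ ^ 2 ≤ 2 * (‖a‖ ^ 2 + ‖b‖ ^ 2) := by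
  nlinarith [norm_add_le a b, norm_nonneg (a + b), sq_nonneg (‖a‖ - ‖b‖)]

theorem norm_add_add_sq_le_three_mul {E : Type*} [SeminormedAddCommGroup E] (a b c : E) :
    ‖a + b + c‖ ^ 2 ≤ 3 * (‖a‖ ^ 2 + ‖b‖ ^ 2 + ‖c‖ ^ 2) := by
  nlinarith [norm_add₃_le (a := a) (b := b) (c := c), norm_nonneg (a + b + c),
    sq_nonneg (‖a‖ - ‖b‖), sq_nonneg (‖a‖ - ‖c‖), sq_nonneg (‖b‖ - ‖c‖)]

/-- **Lemma 3.1.**  For a sequence generated by the majorized iPADMM, the KKT residual map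
`ℛ(u) = (y − Pr_p[y − (∇f(y)+𝒜x)], z − Pr_q[z − (∇g(z)+ℬx)], c − 𝒜*y − ℬ*z)` satisfies, for
every `k ≥ 0`, `‖ℛ(u^{k+1})‖² ≤ ‖u^{k+1} − u^k‖²_{ℋ₀}` where
`ℋ₀ = max{κ₁,κ₂,κ₃}·Diag(I, I + σℬℬ*, (τ²σ)⁻¹I)`. -/
theorem stmt0 {X Y Z : Type*}
    [NormedAddCommGroup X] [InnerProductSpace ℝ X] [FiniteDimensional ℝ X]
    [NormedAddCommGroup Y] [InnerProductSpace ℝ Y] [FiniteDimensional ℝ Y]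
    [NormedAddCommGroup Z] [InnerProductSpace ℝ Z] [FiniteDimensional ℝ Z]
    (A : X →ₗ[ℝ] Y) (B : X →ₗ[ℝ] Z) (c : X)
    (f : Y → ℝ) (g : Z → ℝ) (gradf : Y → Y) (gradg : Z → Z)
    (hfconv : ConvexOn ℝ Set.univ f) (hgconv : ConvexOn ℝ Set.univ g)
    (hfdiff : ∀ w, HasGradientAt f (gradf w) w)
    (hgdiff : ∀ w, HasGradientAt g (gradg w) w)
    (hfLip : ∃ L : NNReal, LipschitzWith L gradf)
    (hgLip : ∃ L : NNReal, LipschitzWith L gradg)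
    (p : Y → EReal) (q : Z → EReal)
    (hpconv : ERConvex p) (hplsc : LowerSemicontinuous p) (hpproper : ERProper p)
    (hqconv : ERConvex q) (hqlsc : LowerSemicontinuous q) (hqproper : ERProper q)
    (Sf Sfh : Y →ₗ[ℝ] Y) (Sg Sgh : Z →ₗ[ℝ] Z)
    (hSfsym : Sf.IsSymmetric) (hSfh_sym : Sfh.IsSymmetric)
    (hSgsym : Sg.IsSymmetric) (hSghsym : Sgh.IsSymmetric)
    (hSfpos : ∀ w, 0 ≤ quadForm Sf w) (hSfhpos : ∀ w, 0 ≤ quadForm Sfh w)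
    (hSgpos : ∀ w, 0 ≤ quadForm Sg w) (hSghpos : ∀ w, 0 ≤ quadForm Sgh w)
    (hSfle : ∀ w, quadForm Sf w ≤ quadForm Sfh w)
    (hSgle : ∀ w, quadForm Sg w ≤ quadForm Sgh w)
    (hfmaj : ∀ w w' : Y,
      f w' + ⟪gradf w', w - w'⟫ + 1 / 2 * quadForm Sf (w - w') ≤ f w ∧
      f w ≤ f w' + ⟪gradf w', w - w'⟫ + 1 / 2 * quadForm Sfh (w - w'))
    (hgmaj : ∀ w w' : Z,
      g w' + ⟪gradg w', w - w'⟫ + 1 / 2 * quadForm Sg (w - w') ≤ g w ∧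
      g w ≤ g w' + ⟪gradg w', w - w'⟫ + 1 / 2 * quadForm Sgh (w - w'))
    (σ τ : ℝ) (hσ : 0 < σ) (hτ : 0 < τ)
    (S : Y →ₗ[ℝ] Y) (T : Z →ₗ[ℝ] Z)
    (hSsym : S.IsSymmetric) (hTsym : T.IsSymmetric)
    (hS : ∀ w, -(1 / 2) * quadForm Sfh w ≤ quadForm S w)
    (hT : ∀ w, -(1 / 2) * quadForm Sgh w ≤ quadForm T w)
    (proxP : Y → Y) (proxQ : Z → Z)
    (hproxP : ∀ v w : Y,
      p (proxP v) + ((1 / 2 * ‖proxP v - v‖ ^ 2 : ℝ) : EReal)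
        ≤ p w + ((1 / 2 * ‖w - v‖ ^ 2 : ℝ) : EReal))
    (hproxQ : ∀ v w : Z,
      q (proxQ v) + ((1 / 2 * ‖proxQ v - v‖ ^ 2 : ℝ) : EReal)
        ≤ q w + ((1 / 2 * ‖w - v‖ ^ 2 : ℝ) : EReal))
    (y : ℕ → Y) (z : ℕ → Z) (x : ℕ → X)
    (hdomp : ∀ k, p (y k) ≠ ⊤) (hdomq : ∀ k, q (z k) ≠ ⊤)
    (hsubY : ∀ k, ∀ w : Y,
      p (y (k + 1)) + ((⟪y (k + 1), gradf (y k) + A (x k)⟫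
          + σ / 2 * ‖LinearMap.adjoint A (y (k + 1)) + LinearMap.adjoint B (z k) - c‖ ^ 2
          + 1 / 2 * quadForm (Sfh + S) (y (k + 1) - y k) : ℝ) : EReal)
      ≤ p w + ((⟪w, gradf (y k) + A (x k)⟫
          + σ / 2 * ‖LinearMap.adjoint A w + LinearMap.adjoint B (z k) - c‖ ^ 2
          + 1 / 2 * quadForm (Sfh + S) (w - y k) : ℝ) : EReal))
    (hsubZ : ∀ k, ∀ w : Z,
      q (z (k + 1)) + ((⟪z (k + 1), gradg (z k) + B (x k)⟫
          + σ / 2 * ‖LinearMap.adjoint A (y (k + 1)) + LinearMap.adjoint B (z (k + 1)) - c‖ ^ 2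
          + 1 / 2 * quadForm (Sgh + T) (z (k + 1) - z k) : ℝ) : EReal)
      ≤ q w + ((⟪w, gradg (z k) + B (x k)⟫
          + σ / 2 * ‖LinearMap.adjoint A (y (k + 1)) + LinearMap.adjoint B w - c‖ ^ 2
          + 1 / 2 * quadForm (Sgh + T) (w - z k) : ℝ) : EReal))
    (hxup : ∀ k, x (k + 1)
      = x k + (τ * σ) • (LinearMap.adjoint A (y (k + 1)) + LinearMap.adjoint B (z (k + 1)) - c))
    (hKKTne : (KKTset A B c gradf gradg p q).Nonempty) :
    ∀ k : ℕ,
      let κ₁ : ℝ := 3 * (lamMax (S + (1 / 2 : ℝ) • Sfh) + 1 / 2 * lamMax Sfh) ^ 2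
      let κ₂ : ℝ := max (2 * (lamMax (T + (1 / 2 : ℝ) • Sgh) + 1 / 2 * lamMax Sgh) ^ 2)
        (3 * σ * lamMax (LinearMap.adjoint A ∘ₗ A))
      let κ₃ : ℝ := σ⁻¹ + (1 - τ) ^ 2 * σ
        * (3 * lamMax (LinearMap.adjoint A ∘ₗ A) + 2 * lamMax (LinearMap.adjoint B ∘ₗ B))
      ‖y (k + 1) - proxP (y (k + 1) - (gradf (y (k + 1)) + A (x (k + 1))))‖ ^ 2
        + ‖z (k + 1) - proxQ (z (k + 1) - (gradg (z (k + 1)) + B (x (k + 1))))‖ ^ 2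
        + ‖c - LinearMap.adjoint A (y (k + 1)) - LinearMap.adjoint B (z (k + 1))‖ ^ 2
      ≤ max κ₁ (max κ₂ κ₃)
        * (‖y (k + 1) - y k‖ ^ 2
          + (‖z (k + 1) - z k‖ ^ 2 + σ * ‖LinearMap.adjoint B (z (k + 1) - z k)‖ ^ 2)
          + (τ ^ 2 * σ)⁻¹ * ‖x (k + 1) - x k‖ ^ 2) := by
  intro k κ₁ κ₂ κ₃
  set r := LinearMap.adjoint A (y (k + 1)) + LinearMap.adjoint B (z (k + 1)) - c with hr
  set dy := y (k + 1) - y k with hdy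
  set dz := z (k + 1) - z k with hdz
  have hx : x (k + 1) - x k = (τ * σ) • r := by rw [hxup k, add_sub_cancel_left]
  have hx' : x (k + 1) = x k + (τ * σ) • r := hxup k
  -- the `y`-component
  have hGy := erSubgrad_of_subproblem hpconv hpproper.2 A (hSfh_sym.add hSsym)
    (r := fun w => LinearMap.adjoint A w + LinearMap.adjoint B (z k) - c)
    (b := LinearMap.adjoint B (z k) - c) (fun w => add_sub_assoc _ _ _) (hdomp (k + 1)) (hsubY k)
  have hRy := norm_sub_prox_le hpconv hpproper.2 hproxP (hdomp (k + 1)) hGy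
    (gradf (y (k + 1)) + A (x (k + 1)))
  have hry : LinearMap.adjoint A (y (k + 1)) + LinearMap.adjoint B (z k) - c
      = r - LinearMap.adjoint B dz := by
    rw [hr, hdz, map_sub]
    abel
  have hstepY := norm_majorized_step_le hSfh_sym hSsym hSfhpos hS
    (fun w w' => by linarith [(hfmaj w w').1, hSfpos (w - w')])
    (fun w w' => (hfmaj w w').2) (y k) (y (k + 1))
  rw [← hdy] at hstepY hRy
  set eY := (Sfh + S) dy - (gradf (y (k + 1)) - gradf (y k))
  have hdecY : gradf (y k) + A (x k)
      + σ • A (LinearMap.adjoint A (y (k + 1)) + LinearMap.adjoint B (z k) - c) + (Sfh + S) dy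
      - (gradf (y (k + 1)) + A (x (k + 1)))
      = eY + ((1 - τ) * σ) • A r + (-σ) • A (LinearMap.adjoint B dz) := by
    rw [hry, hx']
    simp only [map_add, map_sub, map_smul, eY]
    module
  rw [hdecY] at hRy
  have hYsq := (pow_le_pow_left₀ (norm_nonneg _) hRy 2).trans
    (norm_add_add_sq_le_three_mul _ _ _)
  have heYsq := pow_le_pow_left₀ (norm_nonneg _) hstepY 2
  have hAr := norm_sq_le_lamMax_adjoint_comp A r
  have hABz := norm_sq_le_lamMax_adjoint_comp A (LinearMap.adjoint B dz)
  -- the `z`-component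
  have hGz := erSubgrad_of_subproblem hqconv hqproper.2 B (hSghsym.add hTsym)
    (r := fun w => LinearMap.adjoint A (y (k + 1)) + LinearMap.adjoint B w - c)
    (b := LinearMap.adjoint A (y (k + 1)) - c) (fun w => by abel) (hdomq (k + 1)) (hsubZ k)
  have hRz := norm_sub_prox_le hqconv hqproper.2 hproxQ (hdomq (k + 1)) hGz
    (gradg (z (k + 1)) + B (x (k + 1)))
  have hstepZ := norm_majorized_step_le hSghsym hTsym hSghpos hT
    (fun w w' => by linarith [(hgmaj w w').1, hSgpos (w - w')])
    (fun w w' => (hgmaj w w').2) (z k) (z (k + 1))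
  rw [← hdz] at hstepZ hRz
  set eZ := (Sgh + T) dz - (gradg (z (k + 1)) - gradg (z k))
  have hdecZ : gradg (z k) + B (x k) + σ • B r + (Sgh + T) dz
      - (gradg (z (k + 1)) + B (x (k + 1))) = eZ + ((1 - τ) * σ) • B r := by
    rw [hx']
    simp only [map_add, map_smul, eZ]
    module
  rw [← hr, hdecZ] at hRz
  have hZsq := (pow_le_pow_left₀ (norm_nonneg _) hRz 2).trans (norm_add_sq_le_two_mul _ _)
  have heZsq := pow_le_pow_left₀ (norm_nonneg _) hstepZ 2
  have hBr := norm_sq_le_lamMax_adjoint_comp B r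
  -- assembling the three components
  have hc : ‖c - LinearMap.adjoint A (y (k + 1)) - LinearMap.adjoint B (z (k + 1))‖ = ‖r‖ := by
    rw [← norm_neg, hr]
    congr 1
    abel
  have hxsq : (τ ^ 2 * σ)⁻¹ * ‖x (k + 1) - x k‖ ^ 2 = σ * ‖r‖ ^ 2 := by
    rw [hx, norm_smul, mul_pow, Real.norm_eq_abs, sq_abs]
    field_simp
  rw [norm_smul, norm_smul, mul_pow, mul_pow, Real.norm_eq_abs, Real.norm_eq_abs, sq_abs, sq_abs]
    at hYsq
  rw [norm_smul, mul_pow, Real.norm_eq_abs, sq_abs] at hZsq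
  rw [mul_pow] at heYsq heZsq
  rw [hc, hxsq]
  set K := max κ₁ (max κ₂ κ₃)
  have hK₁ : κ₁ ≤ K := le_max_left _ _
  have hK₂ : κ₂ ≤ K := (le_max_left _ _).trans (le_max_right _ _)
  have hK₃ : κ₃ ≤ K := (le_max_right _ _).trans (le_max_right _ _)
  have b₁ := mul_le_mul_of_nonneg_right hK₁ (sq_nonneg ‖dy‖)
  have b₂ := mul_le_mul_of_nonneg_right ((le_max_left _ _).trans hK₂) (sq_nonneg ‖dz‖)
  have b₃ := mul_le_mul_of_nonneg_right ((le_max_right _ _).trans hK₂)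
    (mul_nonneg hσ.le (sq_nonneg ‖LinearMap.adjoint B dz‖))
  have b₄ := mul_le_mul_of_nonneg_right hK₃ (mul_nonneg hσ.le (sq_nonneg ‖r‖))
  have e₄ : κ₃ * (σ * ‖r‖ ^ 2)
      = ‖r‖ ^ 2 + ((1 - τ) * σ) ^ 2 * ((3 * lamMax (LinearMap.adjoint A ∘ₗ A)
        + 2 * lamMax (LinearMap.adjoint B ∘ₗ B)) * ‖r‖ ^ 2) := by
    simp only [κ₃]
    field_simp
  have c₁ := mul_le_mul_of_nonneg_left hAr (sq_nonneg ((1 - τ) * σ))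
  have c₂ := mul_le_mul_of_nonneg_left hABz (sq_nonneg (-σ))
  have c₃ := mul_le_mul_of_nonneg_left hBr (sq_nonneg ((1 - τ) * σ))
  simp only [κ₁] at b₁
  linarith

end
end

section
/- Let 𝒳 be a finite-dimensional real inner product space, let h : 𝒳 → ℝ be a differentiable convex function, and let 𝒫 be a self-adjoint positive semidefinite linear operator on 𝒳 such that h(x) ≤ h(x̄) + ⟨∇h(x̄), x − x̄⟩ + ½‖x − x̄‖²_𝒫 for all x, x̄ ∈ 𝒳. Then for all x̄, x, y ∈ 𝒳 one has ⟨∇h(x) − ∇h(x̄), y − x̄⟩ ≥ −¼‖x − y‖²_𝒫. -/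
open scoped RealInnerProductSpace

/-- A convex function lies above its tangent hyperplanes. -/
theorem ConvexOn.add_inner_le_of_hasGradientAt {X : Type*} [NormedAddCommGroup X]
    [InnerProductSpace ℝ X] [CompleteSpace X] {h : X → ℝ} {g x : X}
    (hconv : ConvexOn ℝ Set.univ h) (hg : HasGradientAt h g x) (y : X) :
    h x + ⟪g, y - x⟫ ≤ h y := by
  have hline : ConvexOn ℝ Set.univ (h ∘ AffineMap.lineMap (k := ℝ) x y) :=
    hconv.comp_affineMap (AffineMap.lineMap (k := ℝ) x y)
  have hderiv : HasDerivAt (h ∘ AffineMap.lineMap (k := ℝ) x y) ⟪g, y - x⟫ 0 := by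
    have hx : HasFDerivAt h (InnerProductSpace.toDual ℝ X g)
        (AffineMap.lineMap (k := ℝ) x y 0) := by
      simpa using hg.hasFDerivAt
    simpa using hx.comp_hasDerivAt (0 : ℝ) AffineMap.hasDerivAt_lineMap
  have hslope := hline.le_slope_of_hasDerivAt (Set.mem_univ 0) (Set.mem_univ 1)
    zero_lt_one hderiv
  simp only [slope_def_field, Function.comp_apply, AffineMap.lineMap_apply_zero,
    AffineMap.lineMap_apply_one, sub_zero, div_one] at hslope
  linarith

/-- **Lemma 3.2.** Let `𝒳` be a finite-dimensional real inner product space, `h : 𝒳 → ℝ` a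
differentiable convex function, and `𝒫` a self-adjoint positive semidefinite linear operator
such that `h(x) ≤ h(x̄) + ⟨∇h(x̄), x − x̄⟩ + ½‖x − x̄‖²_𝒫` for all `x, x̄`.  Then for all
`x̄, x, y` one has `⟨∇h(x) − ∇h(x̄), y − x̄⟩ ≥ −¼‖x − y‖²_𝒫`. -/
theorem stmt1 {X : Type*} [NormedAddCommGroup X] [InnerProductSpace ℝ X]
    [FiniteDimensional ℝ X]
    (h : X → ℝ) (gradh : X → X)
    (hconv : ConvexOn ℝ Set.univ h)
    (hdiff : ∀ x, HasGradientAt h (gradh x) x)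
    (P : X →ₗ[ℝ] X) (hPsym : P.IsSymmetric)
    (hPpos : ∀ w, 0 ≤ ⟪w, P w⟫)
    (hmaj : ∀ x xbar : X,
      h x ≤ h xbar + ⟪gradh xbar, x - xbar⟫ + 1 / 2 * ⟪x - xbar, P (x - xbar)⟫) :
    ∀ xbar x y : X,
      -(1 / 4) * ⟪x - y, P (x - y)⟫ ≤ ⟪gradh x - gradh xbar, y - xbar⟫ := by
  intro xbar x y
  set d : X := (1 / 2 : ℝ) • (y - x) with hd
  have hup := hmaj (x + d) x
  have hlow := hconv.add_inner_le_of_hasGradientAt (hdiff xbar) (x + d)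
  have hup' := hmaj (xbar - d) xbar
  have hlow' := hconv.add_inner_le_of_hasGradientAt (hdiff x) (xbar - d)
  have hquad : ⟪d, P d⟫ = 1 / 4 * ⟪x - y, P (x - y)⟫ := by
    rw [hd, ← neg_sub x y]
    simp only [map_smul, map_neg, inner_smul_left, inner_smul_right, inner_neg_neg]
    simp
    ring
  have hlin : ∀ g : X, ⟪g, d⟫ = 1 / 2 * (⟪g, y⟫ - ⟪g, x⟫) := fun g => by
    rw [hd, inner_smul_right, inner_sub_right]
  have hneg : xbar - d - xbar = -d := by abel
  rw [add_sub_cancel_left, hquad] at hup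
  rw [hneg, map_neg, inner_neg_neg, hquad] at hup'
  simp only [inner_sub_left, inner_sub_right, inner_add_right, inner_neg_right, hlin]
    at hup hlow hup' hlow' ⊢
  linarith
end

section
/- Let 𝒳 be a finite-dimensional real inner product space, let h : 𝒳 → ℝ be a differentiable convex function, and let Q be a self-adjoint positive definite linear operator on 𝒳 such that h(x) ≤ h(y) + ⟨∇h(y), x − y⟩ + ½‖x − y‖²_Q for all x, y ∈ 𝒳. Then for all x, y ∈ 𝒳 one has the generalized cocoercivity inequality ⟨∇h(x) − ∇h(y), x − y⟩ ≥ ‖∇h(x) − ∇h(y)‖²_{Q⁻¹}. -/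
open scoped RealInnerProductSpace

/-- A convex function lies above its tangent hyperplane at any point of differentiability. -/
theorem ConvexOn.add_inner_gradient_le {X : Type*} [NormedAddCommGroup X]
    [InnerProductSpace ℝ X] [CompleteSpace X] {h : X → ℝ} {g x : X}
    (hconv : ConvexOn ℝ Set.univ h) (hg : HasGradientAt h g x) (z : X) :
    h x + ⟪g, z - x⟫ ≤ h z := by
  have hline : ConvexOn ℝ Set.univ (h ∘ AffineMap.lineMap x z) :=
    hconv.comp_affineMap (AffineMap.lineMap x z : ℝ →ᵃ[ℝ] X)
  have hderiv : HasDerivAt (h ∘ AffineMap.lineMap x z) ⟪g, z - x⟫ (0 : ℝ) := by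
    have hf : HasFDerivAt h (InnerProductSpace.toDual ℝ X g)
        (AffineMap.lineMap x z (0 : ℝ)) := by
      simpa using hg.hasFDerivAt
    simpa using hf.comp_hasDerivAt (0 : ℝ) AffineMap.hasDerivAt_lineMap
  have hslope := hline.le_slope_of_hasDerivAt (Set.mem_univ 0) (Set.mem_univ 1) one_pos hderiv
  simp only [slope_def_field, Function.comp_apply, AffineMap.lineMap_apply_zero,
    AffineMap.lineMap_apply_one, sub_zero, div_one] at hslope
  linarith

/-- The tangent-hyperplane bound of a convex function with a quadratic majorant improves by
half the squared dual norm of the gradient difference. -/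
theorem ConvexOn.add_inner_add_half_dual_le {X : Type*} [NormedAddCommGroup X]
    [InnerProductSpace ℝ X] [CompleteSpace X] {h : X → ℝ} {gradh : X → X}
    (hconv : ConvexOn ℝ Set.univ h) (hdiff : ∀ x, HasGradientAt h (gradh x) x)
    {Q Qinv : X →ₗ[ℝ] X} (hQinv : ∀ w : X, Q (Qinv w) = w)
    (hmaj : ∀ x y : X,
      h x ≤ h y + ⟪gradh y, x - y⟫ + 1 / 2 * ⟪x - y, Q (x - y)⟫) (x y : X) :
    h y + ⟪gradh y, x - y⟫ + 1 / 2 * ⟪gradh x - gradh y, Qinv (gradh x - gradh y)⟫ ≤ h x := by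
  set p := Qinv (gradh x - gradh y)
  have hlower := hconv.add_inner_gradient_le (hdiff y) (x - p)
  have hupper := hmaj (x - p) x
  have hQp : Q p = gradh x - gradh y := hQinv _
  rw [sub_sub_cancel_left, map_neg, inner_neg_neg, hQp, inner_neg_right,
    real_inner_comm] at hupper
  rw [sub_right_comm, inner_sub_right] at hlower
  simp only [inner_sub_left, inner_sub_right, real_inner_comm p] at hlower hupper ⊢
  linarith

/-- **Generalized cocoercivity.** Let `𝒳` be a finite-dimensional real inner product space,
`h : 𝒳 → ℝ` a differentiable convex function, and `Q` a self-adjoint positive definite linear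
operator such that `h(x) ≤ h(y) + ⟨∇h(y), x − y⟩ + ½‖x − y‖²_Q` for all `x, y`.  Then for all
`x, y`: `⟨∇h(x) − ∇h(y), x − y⟩ ≥ ‖∇h(x) − ∇h(y)‖²_{Q⁻¹}`, where `Q⁻¹` is the inverse of `Q`
(which exists since `Q` is positive definite; here it is supplied together with the identities
characterizing it uniquely). -/
theorem stmt2 {X : Type*} [NormedAddCommGroup X] [InnerProductSpace ℝ X]
    [FiniteDimensional ℝ X]
    (h : X → ℝ) (gradh : X → X)
    (hconv : ConvexOn ℝ Set.univ h)
    (hdiff : ∀ x, HasGradientAt h (gradh x) x)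
    (Q : X →ₗ[ℝ] X) (hQsym : Q.IsSymmetric)
    (hQpos : ∀ w : X, w ≠ 0 → 0 < ⟪w, Q w⟫)
    (Qinv : X →ₗ[ℝ] X)
    (hQinv : ∀ w : X, Qinv (Q w) = w ∧ Q (Qinv w) = w)
    (hmaj : ∀ x y : X,
      h x ≤ h y + ⟪gradh y, x - y⟫ + 1 / 2 * ⟪x - y, Q (x - y)⟫) :
    ∀ x y : X,
      ⟪gradh x - gradh y, Qinv (gradh x - gradh y)⟫ ≤ ⟪gradh x - gradh y, x - y⟫ := by
  intro x y
  have hxy := hconv.add_inner_add_half_dual_le hdiff (fun w => (hQinv w).2) hmaj x y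
  have hyx := hconv.add_inner_add_half_dual_le hdiff (fun w => (hQinv w).2) hmaj y x
  rw [← neg_sub (gradh x), map_neg, inner_neg_neg, ← neg_sub x, inner_neg_right] at hyx
  rw [inner_sub_left _ _ (x - y)]
  linarith
end

section
/- Let {(y^k, z^k, x^k)}_{k≥0} be a sequence generated by the majorized iPADMM. For a KKT point ū = (ȳ, z̄, x̄) ∈ Ω̄, define φ_k := (τσ)⁻¹‖x^k − x̄‖² + ‖y^k − ȳ‖²_{Σ̂_f + 𝒮} + ‖z^k − z̄‖²_{Σ̂_g + 𝒯 + σℬℬ*}. Then for every KKT point ū, every τ > 0 and every k ≥ 0: φ_k − φ_{k+1} ≥ ‖y^{k+1} − y^k‖²_{½Σ̂_f + 𝒮} + ‖z^{k+1} − z^k‖²_{½Σ̂_g + 𝒯} + (1 − τ)σ‖r^{k+1}‖² + σ‖𝒜*y^{k+1} + ℬ*z^k − c‖². -/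
open scoped RealInnerProductSpace

noncomputable section

lemma quadForm_sub {E : Type*} [NormedAddCommGroup E] [InnerProductSpace ℝ E]
    {M : E →ₗ[ℝ] E} (hM : M.IsSymmetric) (v w : E) :
    quadForm M (v - w) = quadForm M v - 2 * ⟪M v, w⟫ + quadForm M w := by
  have h : ⟪v, M w⟫ = ⟪M v, w⟫ := (hM v w).symm
  have h' : ⟪w, M v⟫ = ⟪M v, w⟫ := real_inner_comm _ _
  simp only [quadForm, map_sub, inner_sub_left, inner_sub_right]
  linarith

lemma quadForm_add_smul {E : Type*} [NormedAddCommGroup E] [InnerProductSpace ℝ E]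
    {M : E →ₗ[ℝ] E} (hM : M.IsSymmetric) (v w : E) (t : ℝ) :
    quadForm M (v + t • w) = quadForm M v + t * (2 * ⟪M v, w⟫) + t ^ 2 * quadForm M w := by
  have h : ⟪v, M w⟫ = ⟪M v, w⟫ := (hM v w).symm
  have h' : ⟪w, M v⟫ = ⟪M v, w⟫ := real_inner_comm _ _
  simp only [quadForm, map_add, map_smul, inner_add_left, inner_add_right, inner_smul_left,
    inner_smul_right, conj_trivial, h, h']
  ring

/-- A subgradient of a function that is somewhere finite exists only where it is finite. -/
lemma ERSubgrad.ne_top {E : Type*} [NormedAddCommGroup E] [InnerProductSpace ℝ E]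
    {p : E → EReal} {u v g : E} (h : ERSubgrad p u g) (hv : p v ≠ ⊤) : p u ≠ ⊤ := by
  intro hu
  have := h v
  rw [hu, EReal.top_add_coe, top_le_iff] at this
  exact hv this

/-- First-order optimality for the sum of a convex function and a function that is quadratic
along the segment joining the minimizer to a competitor. -/
lemma ERConvex.le_add_of_isMin {E : Type*} [AddCommGroup E] [Module ℝ E]
    {p : E → EReal} (hp : ERConvex p) {φ : E → ℝ} {u w : E} {a b L K : ℝ}
    (hu : p u = (a : EReal)) (hw : p w = (b : EReal))
    (hφ : ∀ t : ℝ, φ (u + t • (w - u)) = φ u + t * L + t ^ 2 * K)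
    (hmin : ∀ v, p u + (φ u : EReal) ≤ p v + (φ v : EReal)) :
    a ≤ b + L := by
  have key : ∀ t : ℝ, 0 < t → t ≤ 1 → a ≤ b + L + t * K := by
    intro t ht ht1
    have hc := hp u w (1 - t) t (by linarith) ht.le (by ring)
    rw [show (1 - t) • u + t • w = u + t • (w - u) by module, hu, hw] at hc
    have hm := (hmin (u + t • (w - u))).trans (add_le_add_left hc _)
    rw [hu, hφ] at hm
    norm_cast at hm
    nlinarith
  refine le_of_forall_pos_le_add fun ε hε => ?_
  have hK : 0 < |K| + 1 := by positivity
  have ht : 0 < min 1 (ε / (|K| + 1)) := lt_min one_pos (by positivity)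
  have h := key _ ht (min_le_left _ _)
  have h1 : min 1 (ε / (|K| + 1)) * K ≤ min 1 (ε / (|K| + 1)) * (|K| + 1) :=
    mul_le_mul_of_nonneg_left (by linarith [le_abs_self K]) ht.le
  have h2 : min 1 (ε / (|K| + 1)) * (|K| + 1) ≤ ε :=
    (le_div_iff₀ hK).1 (min_le_right _ _)
  linarith

/-- A three-point cocoercivity inequality for a function lying above its tangents and below
its quadratic majorants. -/
lemma neg_quarter_quadForm_le_inner_grad_sub {E : Type*} [NormedAddCommGroup E]
    [InnerProductSpace ℝ E] {f : E → ℝ} {gradf : E → E} {M : E →ₗ[ℝ] E}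
    (hlow : ∀ w w', f w' + ⟪gradf w', w - w'⟫ ≤ f w)
    (hupp : ∀ w w', f w ≤ f w' + ⟪gradf w', w - w'⟫ + 1 / 2 * quadForm M (w - w'))
    (u v w : E) :
    -(1 / 4) * quadForm M (w - u) ≤ ⟪gradf u - gradf v, w - v⟫ := by
  have h1 := (hlow (u + (1 / 2 : ℝ) • (w - u)) v).trans (hupp _ u)
  have h2 := (hlow (v - (1 / 2 : ℝ) • (w - u)) u).trans (hupp _ v)
  have e1 : u + (1 / 2 : ℝ) • (w - u) - v = (u - v) + (1 / 2 : ℝ) • (w - u) := by module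
  have e2 : v - (1 / 2 : ℝ) • (w - u) - u = -(u - v) - (1 / 2 : ℝ) • (w - u) := by module
  have e3 : w - v = (u - v) + (w - u) := by abel
  rw [e1, add_sub_cancel_left] at h1
  rw [e2, sub_sub_cancel_left] at h2
  rw [e3]
  generalize u - v = d at *
  generalize w - u = e at *
  simp only [quadForm, map_neg, map_smul, inner_add_right, inner_sub_left, inner_sub_right,
    inner_neg_left, inner_neg_right, inner_smul_left, inner_smul_right, conj_trivial] at *
  linarith

/-- The progress made by one block update of the majorized proximal ADMM, relative to a point
satisfying that block's KKT inclusion. -/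
lemma block_update_progress {X E : Type*}
    [NormedAddCommGroup X] [InnerProductSpace ℝ X] [FiniteDimensional ℝ X]
    [NormedAddCommGroup E] [InnerProductSpace ℝ E] [FiniteDimensional ℝ E]
    (C : X →ₗ[ℝ] E) {f : E → ℝ} {gradf : E → E} {p : E → EReal}
    (hpconv : ERConvex p) (hpbot : ∀ w, p w ≠ ⊥) {M S : E →ₗ[ℝ] E}
    (hM : M.IsSymmetric) (hS : S.IsSymmetric)
    (hlow : ∀ w w', f w' + ⟪gradf w', w - w'⟫ ≤ f w)
    (hupp : ∀ w w', f w ≤ f w' + ⟪gradf w', w - w'⟫ + 1 / 2 * quadForm M (w - w'))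
    {σ : ℝ} {u₀ u ubar : E} {x xbar b : X} (hu : p u ≠ ⊤)
    (hmin : ∀ w, p u + ((⟪u, gradf u₀ + C x⟫ + σ / 2 * ‖LinearMap.adjoint C u + b‖ ^ 2
          + 1 / 2 * quadForm (M + S) (u - u₀) : ℝ) : EReal)
      ≤ p w + ((⟪w, gradf u₀ + C x⟫ + σ / 2 * ‖LinearMap.adjoint C w + b‖ ^ 2
          + 1 / 2 * quadForm (M + S) (w - u₀) : ℝ) : EReal))
    (hbar : ERSubgrad p ubar (-(gradf ubar + C xbar))) :
    quadForm ((1 / 2 : ℝ) • M + S) (u - u₀)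
      ≤ 2 * ⟪xbar - x - σ • (LinearMap.adjoint C u + b), LinearMap.adjoint C (u - ubar)⟫
        + quadForm (M + S) (u₀ - ubar) - quadForm (M + S) (u - ubar) := by
  have hMS : (M + S).IsSymmetric := hM.add hS
  obtain ⟨α, hα⟩ : ∃ α : ℝ, p u = (α : EReal) :=
    ⟨_, (EReal.coe_toReal hu (hpbot u)).symm⟩
  obtain ⟨β, hβ⟩ : ∃ β : ℝ, p ubar = (β : EReal) :=
    ⟨_, (EReal.coe_toReal (hbar.ne_top hu) (hpbot ubar)).symm⟩
  have hopt := hpconv.le_add_of_isMin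
    (φ := fun w => ⟪w, gradf u₀ + C x⟫ + σ / 2 * ‖LinearMap.adjoint C w + b‖ ^ 2
      + 1 / 2 * quadForm (M + S) (w - u₀))
    (L := ⟪ubar - u, gradf u₀ + C x⟫
      + σ * ⟪LinearMap.adjoint C u + b, LinearMap.adjoint C (ubar - u)⟫
      + ⟪(M + S) (u - u₀), ubar - u⟫)
    (K := σ / 2 * ‖LinearMap.adjoint C (ubar - u)‖ ^ 2 + 1 / 2 * quadForm (M + S) (ubar - u))
    hα hβ ?_ hmin
  · have hsub := hbar u
    rw [hα, hβ] at hsub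
    norm_cast at hsub
    have hgrad := neg_quarter_quadForm_le_inner_grad_sub hlow hupp u₀ ubar u
    have hsplit : quadForm (M + S) (u₀ - ubar) = quadForm (M + S) (u - ubar)
        - 2 * ⟪(M + S) (u - u₀), u - ubar⟫ + quadForm (M + S) (u - u₀) := by
      rw [show u₀ - ubar = (u - ubar) - (u - u₀) by abel, quadForm_sub hMS,
        hMS, real_inner_comm]
    have hhalf : quadForm ((1 / 2 : ℝ) • M + S) (u - u₀)
        = quadForm (M + S) (u - u₀) - 1 / 2 * quadForm M (u - u₀) := by
      simp only [quadForm, LinearMap.add_apply, LinearMap.smul_apply, inner_add_right,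
        inner_smul_right]
      ring
    rw [← neg_sub u ubar, map_neg] at hopt
    rw [real_inner_comm, hhalf, hsplit]
    rw [real_inner_comm] at hgrad
    rw [real_inner_comm] at hsub
    simp only [inner_neg_left, inner_neg_right, inner_add_right, inner_sub_right,
      inner_smul_right, LinearMap.adjoint_inner_left] at hopt hsub hgrad ⊢
    have hcomm := real_inner_comm (LinearMap.adjoint C u + b) (LinearMap.adjoint C (u - ubar))
    simp only [inner_add_right, LinearMap.adjoint_inner_left] at hcomm
    rw [← hcomm] at hopt
    linarith
  · intro t
    have e : LinearMap.adjoint C (u + t • (ubar - u)) + b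
        = (LinearMap.adjoint C u + b) + t • LinearMap.adjoint C (ubar - u) := by
      rw [map_add, map_smul]; abel
    have e' : u + t • (ubar - u) - u₀ = (u - u₀) + t • (ubar - u) := by abel
    simp only [e, e', quadForm_add_smul hMS, norm_add_sq_real, norm_smul, mul_pow,
      Real.norm_eq_abs, sq_abs, inner_add_left, inner_smul_left, inner_smul_right, conj_trivial]
    ring

/-- **Lemma 3.3.**  For a sequence generated by the majorized iPADMM and any KKT point
`(ȳ, z̄, x̄)`, with `φ_k := (τσ)⁻¹‖x^k − x̄‖² + ‖y^k − ȳ‖²_{Σ̂_f+𝒮} + ‖z^k − z̄‖²_{Σ̂_g+𝒯+σℬℬ*}`,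
one has for all `k ≥ 0`:
`φ_k − φ_{k+1} ≥ ‖y^{k+1} − y^k‖²_{½Σ̂_f+𝒮} + ‖z^{k+1} − z^k‖²_{½Σ̂_g+𝒯}
  + (1−τ)σ‖r^{k+1}‖² + σ‖𝒜*y^{k+1} + ℬ*z^k − c‖²`. -/
theorem stmt3 {X Y Z : Type*}
    [NormedAddCommGroup X] [InnerProductSpace ℝ X] [FiniteDimensional ℝ X]
    [NormedAddCommGroup Y] [InnerProductSpace ℝ Y] [FiniteDimensional ℝ Y]
    [NormedAddCommGroup Z] [InnerProductSpace ℝ Z] [FiniteDimensional ℝ Z]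
    (A : X →ₗ[ℝ] Y) (B : X →ₗ[ℝ] Z) (c : X)
    (f : Y → ℝ) (g : Z → ℝ) (gradf : Y → Y) (gradg : Z → Z)
    (hfconv : ConvexOn ℝ Set.univ f) (hgconv : ConvexOn ℝ Set.univ g)
    (hfdiff : ∀ w, HasGradientAt f (gradf w) w)
    (hgdiff : ∀ w, HasGradientAt g (gradg w) w)
    (hfLip : ∃ L : NNReal, LipschitzWith L gradf)
    (hgLip : ∃ L : NNReal, LipschitzWith L gradg)
    (p : Y → EReal) (q : Z → EReal)
    (hpconv : ERConvex p) (hplsc : LowerSemicontinuous p) (hpproper : ERProper p)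
    (hqconv : ERConvex q) (hqlsc : LowerSemicontinuous q) (hqproper : ERProper q)
    (Sf Sfh : Y →ₗ[ℝ] Y) (Sg Sgh : Z →ₗ[ℝ] Z)
    (hSfsym : Sf.IsSymmetric) (hSfh_sym : Sfh.IsSymmetric)
    (hSgsym : Sg.IsSymmetric) (hSghsym : Sgh.IsSymmetric)
    (hSfpos : ∀ w, 0 ≤ quadForm Sf w) (hSfhpos : ∀ w, 0 ≤ quadForm Sfh w)
    (hSgpos : ∀ w, 0 ≤ quadForm Sg w) (hSghpos : ∀ w, 0 ≤ quadForm Sgh w)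
    (hSfle : ∀ w, quadForm Sf w ≤ quadForm Sfh w)
    (hSgle : ∀ w, quadForm Sg w ≤ quadForm Sgh w)
    (hfmaj : ∀ w w' : Y,
      f w' + ⟪gradf w', w - w'⟫ + 1 / 2 * quadForm Sf (w - w') ≤ f w ∧
      f w ≤ f w' + ⟪gradf w', w - w'⟫ + 1 / 2 * quadForm Sfh (w - w'))
    (hgmaj : ∀ w w' : Z,
      g w' + ⟪gradg w', w - w'⟫ + 1 / 2 * quadForm Sg (w - w') ≤ g w ∧
      g w ≤ g w' + ⟪gradg w', w - w'⟫ + 1 / 2 * quadForm Sgh (w - w'))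
    (σ τ : ℝ) (hσ : 0 < σ) (hτ : 0 < τ)
    (S : Y →ₗ[ℝ] Y) (T : Z →ₗ[ℝ] Z)
    (hSsym : S.IsSymmetric) (hTsym : T.IsSymmetric)
    (hS : ∀ w, -(1 / 2) * quadForm Sfh w ≤ quadForm S w)
    (hT : ∀ w, -(1 / 2) * quadForm Sgh w ≤ quadForm T w)
    (y : ℕ → Y) (z : ℕ → Z) (x : ℕ → X)
    (hdomp : ∀ k, p (y k) ≠ ⊤) (hdomq : ∀ k, q (z k) ≠ ⊤)
    (hsubY : ∀ k, ∀ w : Y,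
      p (y (k + 1)) + ((⟪y (k + 1), gradf (y k) + A (x k)⟫
          + σ / 2 * ‖LinearMap.adjoint A (y (k + 1)) + LinearMap.adjoint B (z k) - c‖ ^ 2
          + 1 / 2 * quadForm (Sfh + S) (y (k + 1) - y k) : ℝ) : EReal)
      ≤ p w + ((⟪w, gradf (y k) + A (x k)⟫
          + σ / 2 * ‖LinearMap.adjoint A w + LinearMap.adjoint B (z k) - c‖ ^ 2
          + 1 / 2 * quadForm (Sfh + S) (w - y k) : ℝ) : EReal))
    (hsubZ : ∀ k, ∀ w : Z,
      q (z (k + 1)) + ((⟪z (k + 1), gradg (z k) + B (x k)⟫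
          + σ / 2 * ‖LinearMap.adjoint A (y (k + 1)) + LinearMap.adjoint B (z (k + 1)) - c‖ ^ 2
          + 1 / 2 * quadForm (Sgh + T) (z (k + 1) - z k) : ℝ) : EReal)
      ≤ q w + ((⟪w, gradg (z k) + B (x k)⟫
          + σ / 2 * ‖LinearMap.adjoint A (y (k + 1)) + LinearMap.adjoint B w - c‖ ^ 2
          + 1 / 2 * quadForm (Sgh + T) (w - z k) : ℝ) : EReal))
    (hxup : ∀ k, x (k + 1)
      = x k + (τ * σ) • (LinearMap.adjoint A (y (k + 1)) + LinearMap.adjoint B (z (k + 1)) - c))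
    (hKKTne : (KKTset A B c gradf gradg p q).Nonempty)
    (ybar : Y) (zbar : Z) (xbar : X)
    (hKKT : (ybar, zbar, xbar) ∈ KKTset A B c gradf gradg p q) :
    ∀ k : ℕ,
      let φ : ℕ → ℝ := fun j =>
        (τ * σ)⁻¹ * ‖x j - xbar‖ ^ 2 + quadForm (Sfh + S) (y j - ybar)
          + quadForm (Sgh + T + σ • (B ∘ₗ LinearMap.adjoint B)) (z j - zbar)
      quadForm ((1 / 2 : ℝ) • Sfh + S) (y (k + 1) - y k)
        + quadForm ((1 / 2 : ℝ) • Sgh + T) (z (k + 1) - z k)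
        + (1 - τ) * σ * ‖LinearMap.adjoint A (y (k + 1)) + LinearMap.adjoint B (z (k + 1)) - c‖ ^ 2
        + σ * ‖LinearMap.adjoint A (y (k + 1)) + LinearMap.adjoint B (z k) - c‖ ^ 2
      ≤ φ k - φ (k + 1) := by
  intro k φ
  obtain ⟨hpbar, hqbar, hcbar⟩ := hKKT
  have hY := block_update_progress A hpconv hpproper.2 hSfh_sym hSsym
    (fun w w' => by linarith [(hfmaj w w').1, hSfpos (w - w')]) (fun w w' => (hfmaj w w').2)
    (σ := σ) (x := x k) (b := LinearMap.adjoint B (z k) - c) (hdomp (k + 1))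
    (by simpa only [add_sub_assoc] using hsubY k) hpbar
  have hZ := block_update_progress B hqconv hqproper.2 hSghsym hTsym
    (fun w w' => by linarith [(hgmaj w w').1, hSgpos (w - w')]) (fun w w' => (hgmaj w w').2)
    (σ := σ) (x := x k) (b := LinearMap.adjoint A (y (k + 1)) - c) (hdomq (k + 1))
    (by
      have e : ∀ w, LinearMap.adjoint B w + (LinearMap.adjoint A (y (k + 1)) - c)
          = LinearMap.adjoint A (y (k + 1)) + LinearMap.adjoint B w - c := fun w => by abel
      simpa only [e] using hsubZ k) hqbar
  have hB : ∀ w, quadForm (Sgh + T + σ • (B ∘ₗ LinearMap.adjoint B)) w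
      = quadForm (Sgh + T) w + σ * ‖LinearMap.adjoint B w‖ ^ 2 := fun w => by
    simp only [quadForm, LinearMap.add_apply, LinearMap.smul_apply, LinearMap.comp_apply,
      inner_add_right, inner_smul_right]
    rw [← LinearMap.adjoint_inner_left B, real_inner_self_eq_norm_sq]
  simp only [φ, hB]
  set r := LinearMap.adjoint A (y (k + 1)) + LinearMap.adjoint B (z (k + 1)) - c with hr
  set d := LinearMap.adjoint B (z (k + 1) - z k) with hd
  set e := LinearMap.adjoint B (z (k + 1) - zbar) with he
  set v := x k - xbar with hv
  have hs : LinearMap.adjoint A (y (k + 1)) + LinearMap.adjoint B (z k) - c = r - d := by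
    rw [hr, hd, map_sub]; abel
  have hs' : LinearMap.adjoint A (y (k + 1)) + (LinearMap.adjoint B (z k) - c) = r - d := by
    rw [← hs]; abel
  have hr' : LinearMap.adjoint B (z (k + 1)) + (LinearMap.adjoint A (y (k + 1)) - c) = r := by
    rw [hr]; abel
  have hA : LinearMap.adjoint A (y (k + 1) - ybar) = r - e := by
    have h : LinearMap.adjoint A ybar + LinearMap.adjoint B zbar = c := hcbar
    rw [hr, he, map_sub, map_sub, ← h]; abel
  have hez : LinearMap.adjoint B (z k - zbar) = e - d := by
    rw [he, hd, ← map_sub]; congr 1; abel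
  have hx : x (k + 1) - xbar = v + (τ * σ) • r := by rw [hxup k, hv]; abel
  have hxsq : (τ * σ)⁻¹ * ‖x (k + 1) - xbar‖ ^ 2
      = (τ * σ)⁻¹ * ‖v‖ ^ 2 + 2 * ⟪v, r⟫ + τ * σ * ‖r‖ ^ 2 := by
    rw [hx, norm_add_sq_real, norm_smul, mul_pow, Real.norm_eq_abs, sq_abs, inner_smul_right]
    field_simp
  rw [hs', hA, ← neg_sub (x k) xbar] at hY
  rw [hr', ← neg_sub (x k) xbar] at hZ
  rw [hs, hez, hxsq, norm_sub_sq_real r d, norm_sub_sq_real e d]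
  simp only [inner_sub_left, inner_sub_right, inner_neg_left, inner_smul_left, conj_trivial,
    real_inner_self_eq_norm_sq, ← hv] at hY hZ
  rw [real_inner_comm d e, real_inner_comm d r]
  linarith

end
end

section
/- Let τ ∈ (0, (1+√5)/2). Then the following hold: (i) ½Σ̂_f + 𝒮 + σ𝒜𝒜* ≻ 0 and ½Σ̂_g + 𝒯 + σℬℬ* ≻ 0 if and only if ℋ ≻ 0; and (ii) if ℋ ≻ 0 then ℳ ≻ 0. -/
open scoped RealInnerProductSpace

noncomputable section

theorem quadForm_add_s5 {E : Type*} [NormedAddCommGroup E] [InnerProductSpace ℝ E]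
    (M N : E →ₗ[ℝ] E) (w : E) : quadForm (M + N) w = quadForm M w + quadForm N w := by
  simp [quadForm, inner_add_right]

theorem quadForm_smul_s5 {E : Type*} [NormedAddCommGroup E] [InnerProductSpace ℝ E]
    (c : ℝ) (M : E →ₗ[ℝ] E) (w : E) : quadForm (c • M) w = c * quadForm M w := by
  simp [quadForm, inner_smul_right]

theorem quadForm_comp_adjoint {E F : Type*}
    [NormedAddCommGroup E] [InnerProductSpace ℝ E] [FiniteDimensional ℝ E]
    [NormedAddCommGroup F] [InnerProductSpace ℝ F] [FiniteDimensional ℝ F]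
    (A : E →ₗ[ℝ] F) (w : F) :
    quadForm (A ∘ₗ LinearMap.adjoint A) w = ‖LinearMap.adjoint A w‖ ^ 2 := by
  rw [quadForm, LinearMap.comp_apply, ← LinearMap.adjoint_inner_left, real_inner_self_eq_norm_sq]

theorem one_sub_add_min_inv_pos {τ : ℝ} (hτ : 0 < τ) (hτ' : τ < (1 + Real.sqrt 5) / 2) :
    0 < 1 - τ + min τ τ⁻¹ := by
  have hsqrt : Real.sqrt 5 ^ 2 = 5 := Real.sq_sqrt (by norm_num)
  have hinv : τ * τ⁻¹ = 1 := mul_inv_cancel₀ hτ.ne'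
  have hquad : τ ^ 2 < τ + 1 := by
    have hone : 1 < Real.sqrt 5 := by rw [Real.lt_sqrt] <;> norm_num
    nlinarith [mul_pos (sub_pos.2 hτ') (show 0 < τ - (1 - Real.sqrt 5) / 2 by linarith)]
  rcases min_choice τ τ⁻¹ with h | h <;> rw [h]
  · linarith
  · nlinarith

theorem five_sub_sub_three_mul_min_inv_pos {τ : ℝ} (hτ : 0 < τ)
    (hτ' : τ < (1 + Real.sqrt 5) / 2) : 0 < 5 - τ - 3 * min τ τ⁻¹ := by
  have hsqrt : Real.sqrt 5 < 3 := by
    rw [Real.sqrt_lt' (by norm_num)]; norm_num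
  have hinv : τ * τ⁻¹ = 1 := mul_inv_cancel₀ hτ.ne'
  rcases le_total τ 1 with h | h
  · linarith [min_le_left τ τ⁻¹]
  · have : 0 < 5 - τ - 3 * τ⁻¹ := by nlinarith
    linarith [min_le_right τ τ⁻¹]

/-- Positivity of a combination of nonnegative terms does not depend on the positive weight. -/
theorem add_mul_pos_of_add_mul_pos {p a c d : ℝ} (hp : 0 ≤ p) (ha : 0 ≤ a) (hd : 0 < d)
    (h : 0 < p + c * a) : 0 < p + d * a := by
  rcases ha.eq_or_lt with rfl | ha
  · simpa using h
  · positivity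

/-- **Lemma 3.5.**  For `τ ∈ (0, (1+√5)/2)`:
`½Σ̂_f + 𝒮 + σ𝒜𝒜* ≻ 0` and `½Σ̂_g + 𝒯 + σℬℬ* ≻ 0` iff `ℋ ≻ 0`; moreover `ℋ ≻ 0 ⟹ ℳ ≻ 0`.
Here `ℳ = Diag(Σ̂_f+𝒮, Σ̂_g+𝒯+σℬℬ*, (τσ)⁻¹I) + s_τσℰℰ*` and
`ℋ = Diag(½Σ̂_f+𝒮, ½Σ̂_g+𝒯+2t_τττσℬℬ*, t_τ(τ²σ)⁻¹I) + ¼t_τσℰℰ*` with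
`ℰ*(y,z,x) = 𝒜*y + ℬ*z`; positive definiteness of a self-adjoint operator is expressed by the
positivity of its quadratic form on nonzero vectors. -/
theorem stmt5 {X Y Z : Type*}
    [NormedAddCommGroup X] [InnerProductSpace ℝ X] [FiniteDimensional ℝ X]
    [NormedAddCommGroup Y] [InnerProductSpace ℝ Y] [FiniteDimensional ℝ Y]
    [NormedAddCommGroup Z] [InnerProductSpace ℝ Z] [FiniteDimensional ℝ Z]
    (A : X →ₗ[ℝ] Y) (B : X →ₗ[ℝ] Z)
    (σ : ℝ) (hσ : 0 < σ)
    (Sfh : Y →ₗ[ℝ] Y) (Sgh : Z →ₗ[ℝ] Z)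
    (hSfh_sym : Sfh.IsSymmetric) (hSghsym : Sgh.IsSymmetric)
    (hSfhpos : ∀ w, 0 ≤ quadForm Sfh w) (hSghpos : ∀ w, 0 ≤ quadForm Sgh w)
    (S : Y →ₗ[ℝ] Y) (T : Z →ₗ[ℝ] Z)
    (hSsym : S.IsSymmetric) (hTsym : T.IsSymmetric)
    (hS : ∀ w, -(1 / 2) * quadForm Sfh w ≤ quadForm S w)
    (hT : ∀ w, -(1 / 2) * quadForm Sgh w ≤ quadForm T w)
    (τ : ℝ) (hτ : 0 < τ ∧ τ < (1 + Real.sqrt 5) / 2) :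
    let sτ : ℝ := (5 - τ - 3 * min τ τ⁻¹) / 4
    let tτ : ℝ := (1 - τ + min τ τ⁻¹) / 2
    let quadM : Y → Z → X → ℝ := fun dy dz dx =>
      quadForm (Sfh + S) dy
        + quadForm (Sgh + T + σ • (B ∘ₗ LinearMap.adjoint B)) dz
        + (τ * σ)⁻¹ * ‖dx‖ ^ 2
        + sτ * σ * ‖LinearMap.adjoint A dy + LinearMap.adjoint B dz‖ ^ 2
    let quadH : Y → Z → X → ℝ := fun dy dz dx =>
      quadForm ((1 / 2 : ℝ) • Sfh + S) dy
        + quadForm ((1 / 2 : ℝ) • Sgh + T + (2 * tτ * τ * σ) • (B ∘ₗ LinearMap.adjoint B)) dz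
        + tτ * (τ ^ 2 * σ)⁻¹ * ‖dx‖ ^ 2
        + 1 / 4 * tτ * σ * ‖LinearMap.adjoint A dy + LinearMap.adjoint B dz‖ ^ 2
    (((∀ w : Y, w ≠ 0 →
          0 < quadForm ((1 / 2 : ℝ) • Sfh + S + σ • (A ∘ₗ LinearMap.adjoint A)) w) ∧
        (∀ w : Z, w ≠ 0 →
          0 < quadForm ((1 / 2 : ℝ) • Sgh + T + σ • (B ∘ₗ LinearMap.adjoint B)) w)) ↔
      (∀ dy : Y, ∀ dz : Z, ∀ dx : X, (dy, dz, dx) ≠ 0 → 0 < quadH dy dz dx)) ∧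
    ((∀ dy : Y, ∀ dz : Z, ∀ dx : X, (dy, dz, dx) ≠ 0 → 0 < quadH dy dz dx) →
      (∀ dy : Y, ∀ dz : Z, ∀ dx : X, (dy, dz, dx) ≠ 0 → 0 < quadM dy dz dx)) := by
  intro sτ tτ quadM quadH
  have ht : 0 < tτ := half_pos (one_sub_add_min_inv_pos hτ.1 hτ.2)
  have hs : 0 < sτ := div_pos (five_sub_sub_three_mul_min_inv_pos hτ.1 hτ.2) (by norm_num)
  have hτ0 : 0 < τ := hτ.1
  have hp (w : Y) : 0 ≤ 1 / 2 * quadForm Sfh w + quadForm S w := by linarith [hS w]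
  have hq (w : Z) : 0 ≤ 1 / 2 * quadForm Sgh w + quadForm T w := by linarith [hT w]
  have hM (dy : Y) (dz : Z) (dx : X) : quadM dy dz dx =
      1 / 2 * quadForm Sfh dy + (1 / 2 * quadForm Sfh dy + quadForm S dy)
        + (1 / 2 * quadForm Sgh dz + (1 / 2 * quadForm Sgh dz + quadForm T dz)
          + σ * ‖LinearMap.adjoint B dz‖ ^ 2)
        + (τ * σ)⁻¹ * ‖dx‖ ^ 2
        + sτ * σ * ‖LinearMap.adjoint A dy + LinearMap.adjoint B dz‖ ^ 2 := by
    simp only [quadM, quadForm_add_s5, quadForm_smul_s5, quadForm_comp_adjoint]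
    ring
  have hH (dy : Y) (dz : Z) (dx : X) : quadH dy dz dx =
      (1 / 2 * quadForm Sfh dy + quadForm S dy)
        + (1 / 2 * quadForm Sgh dz + quadForm T dz
          + 2 * tτ * τ * σ * ‖LinearMap.adjoint B dz‖ ^ 2)
        + tτ * (τ ^ 2 * σ)⁻¹ * ‖dx‖ ^ 2
        + 1 / 4 * tτ * σ * ‖LinearMap.adjoint A dy + LinearMap.adjoint B dz‖ ^ 2 := by
    simp only [quadH, quadForm_add_s5, quadForm_smul_s5, quadForm_comp_adjoint]
  simp only [hH, hM, quadForm_add_s5, quadForm_smul_s5, quadForm_comp_adjoint]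
  refine ⟨⟨?_, fun h => ⟨fun w hw => ?_, fun w hw => ?_⟩⟩, fun h dy dz dx hne => ?_⟩
  · rintro ⟨hA, hB⟩ dy dz dx hne
    have hx : 0 ≤ tτ * (τ ^ 2 * σ)⁻¹ * ‖dx‖ ^ 2 := by positivity
    have he : 0 ≤ 1 / 4 * tτ * σ * ‖LinearMap.adjoint A dy + LinearMap.adjoint B dz‖ ^ 2 := by
      positivity
    by_cases hz : dz = 0
    · subst hz
      by_cases hy : dy = 0
      · subst hy
        have hdx : dx ≠ 0 := fun h => hne (by simp [h])
        have : 0 < tτ * (τ ^ 2 * σ)⁻¹ * ‖dx‖ ^ 2 := by positivity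
        simpa [quadForm] using this
      · have := add_mul_pos_of_add_mul_pos (hp dy) (sq_nonneg _)
          (show 0 < 1 / 4 * tτ * σ by positivity) (hA dy hy)
        simp only [map_zero, add_zero, norm_zero] at he ⊢
        linarith [hq 0]
    · have := add_mul_pos_of_add_mul_pos (hq dz) (sq_nonneg _)
        (show 0 < 2 * tτ * τ * σ by positivity) (hB dz hz)
      linarith [hp dy]
  · refine add_mul_pos_of_add_mul_pos (hp w) (sq_nonneg _) hσ (c := 1 / 4 * tτ * σ) ?_
    simpa [quadForm] using h w 0 0 (by simp [hw])
  · refine add_mul_pos_of_add_mul_pos (hq w) (sq_nonneg _) hσ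
      (c := 2 * tτ * τ * σ + 1 / 4 * tτ * σ) ?_
    have := h 0 w 0 (by simp [hw])
    simp only [quadForm, map_zero, inner_zero_left, norm_zero, zero_add] at this ⊢
    linarith
  · have hH0 := h dy dz dx hne
    have hb := sq_nonneg ‖LinearMap.adjoint B dz‖
    have hx := sq_nonneg ‖dx‖
    have he := sq_nonneg ‖LinearMap.adjoint A dy + LinearMap.adjoint B dz‖
    have hB : 0 < (1 / 2 * quadForm Sfh dy + quadForm S dy)
        + (1 / 2 * quadForm Sgh dz + quadForm T dz)
        + tτ * (τ ^ 2 * σ)⁻¹ * ‖dx‖ ^ 2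
        + 1 / 4 * tτ * σ * ‖LinearMap.adjoint A dy + LinearMap.adjoint B dz‖ ^ 2
        + σ * ‖LinearMap.adjoint B dz‖ ^ 2 := by
      refine add_mul_pos_of_add_mul_pos (c := 2 * tτ * τ * σ) ?_ hb hσ (by linarith)
      have := hp dy
      have := hq dz
      positivity
    have hX : 0 < (1 / 2 * quadForm Sfh dy + quadForm S dy)
        + (1 / 2 * quadForm Sgh dz + quadForm T dz)
        + 1 / 4 * tτ * σ * ‖LinearMap.adjoint A dy + LinearMap.adjoint B dz‖ ^ 2
        + σ * ‖LinearMap.adjoint B dz‖ ^ 2 + (τ * σ)⁻¹ * ‖dx‖ ^ 2 := by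
      refine add_mul_pos_of_add_mul_pos (c := tτ * (τ ^ 2 * σ)⁻¹) ?_ hx (by positivity)
        (by linarith)
      have := hp dy
      have := hq dz
      positivity
    have hE : 0 < (1 / 2 * quadForm Sfh dy + quadForm S dy)
        + (1 / 2 * quadForm Sgh dz + quadForm T dz)
        + σ * ‖LinearMap.adjoint B dz‖ ^ 2 + (τ * σ)⁻¹ * ‖dx‖ ^ 2
        + sτ * σ * ‖LinearMap.adjoint A dy + LinearMap.adjoint B dz‖ ^ 2 := by
      refine add_mul_pos_of_add_mul_pos (c := 1 / 4 * tτ * σ) ?_ he (by positivity)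
        (by linarith)
      have := hp dy
      have := hq dz
      positivity
    linarith [hSfhpos dy, hSghpos dz]

end
end
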